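/- There is a constant c > 0 such that for all sufficiently small ε > 0 and for all reals d, D, δ > 0 and integers k, n satisfying δ > cε, k < n^{δ/60}, D ≤ 2 log n, and d = εD, the following holds for any family Q ⊆ 2^T of size |Q| ≤ exp(n^{2−δ}). If a k-partite graph G is (Q, D, δ)-good, then every Q ∈ Q that is ruled out by a missing edge satisfies μ_{G,d}(Q) ≤ n^{−c'·ε²·D} for some constant c' > 0 depending only on ε and δ. -/

import Mathlib

open Finset

abbrev Vtx (k n : ℕ) := Fin k × Fin n
abbrev Tup (k n : ℕ) := Fin k → Fin n

/-- Potential edges: pairs of vertices lying in distinct blocks. -/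
def potEdges (k n : ℕ) : Finset (Sym2 (Vtx k n)) :=
  Finset.univ.filter fun e => ¬ (Sym2.map Prod.fst e).IsDiag

open Classical in
/-- The probability, under the distribution `G(n,k,p)` (each potential edge present
independently with probability `p`), that the sampled graph satisfies `P`. -/
noncomputable def probG (k n : ℕ) (p : ℝ) (P : Finset (Sym2 (Vtx k n)) → Prop) : ℝ :=
  ∑ G ∈ (potEdges k n).powerset,
    if P G then p ^ G.card * (1 - p) ^ ((potEdges k n).card - G.card) else 0

/-- The biased character `χ_E(G) = ∏_{e ∈ E} χ_e(G)`. -/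
noncomputable def chiE {k n : ℕ} (p : ℝ) (G E : Finset (Sym2 (Vtx k n))) : ℝ :=
  ∏ e ∈ E, if e ∈ G then (1 - p) / p else -1

/-- The edge of a tuple `t` joining its vertices in blocks `i` and `j`. -/
def tupEdge {k n : ℕ} (t : Tup k n) (i j : Fin k) : Sym2 (Vtx k n) := s((i, t i), (j, t j))

/-- `t` is a `k`-clique of `G`. -/
def IsClique {k n : ℕ} (G : Finset (Sym2 (Vtx k n))) (t : Tup k n) : Prop :=
  ∀ i j : Fin k, i ≠ j → tupEdge t i j ∈ G

/-- `S` is a vertex cover of the graph `H` on `[k]`. -/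
def IsCover {k : ℕ} (H : Finset (Sym2 (Fin k))) (S : Finset (Fin k)) : Prop :=
  ∀ e ∈ H, ∃ v ∈ S, v ∈ e

/-- Minimum vertex cover size. -/
noncomputable def vc {k : ℕ} (H : Finset (Sym2 (Fin k))) : ℕ :=
  sInf {m | ∃ S : Finset (Fin k), S.card = m ∧ IsCover H S}

/-- The graph `H(t)` on the vertices of the tuple `t` obtained from a graph `H` on `[k]`. -/
def graphOf {k n : ℕ} (H : Finset (Sym2 (Fin k))) (t : Tup k n) : Finset (Sym2 (Vtx k n)) :=
  H.image (Sym2.map fun i => (i, t i))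

open Classical in
/-- The pseudo-measure `μ_{G,d}` on a single tuple. -/
noncomputable def mu {k n : ℕ} (p : ℝ) (G : Finset (Sym2 (Vtx k n))) (d : ℝ) (t : Tup k n) : ℝ :=
  ((n : ℝ) ^ k)⁻¹ *
    ∑ H ∈ Finset.univ.filter
        (fun H : Finset (Sym2 (Fin k)) => (∀ e ∈ H, ¬ e.IsDiag) ∧ (vc H : ℝ) ≤ d),
      chiE p G (graphOf H t)

/-- The pseudo-measure `μ_{G,d}` on a set of tuples. -/
noncomputable def muSet {k n : ℕ} (p : ℝ) (G : Finset (Sym2 (Vtx k n))) (d : ℝ)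
    (Q : Finset (Tup k n)) : ℝ :=
  ∑ t ∈ Q, mu p G d t

/-- `Q` is ruled out by a missing edge: some potential edge `e ∉ E(G)` satisfies `e ⊆ t`
for every `t ∈ Q`. -/
def RuledOut {k n : ℕ} (G : Finset (Sym2 (Vtx k n))) (Q : Finset (Tup k n)) : Prop :=
  ∃ e ∈ potEdges k n, e ∉ G ∧ ∀ t ∈ Q, ∀ u ∈ e, t u.1 = u.2


/-- The set of non-isolated vertices `V(E(H))` of a graph `H` on `[k]`. -/
def nonIsolated {k : ℕ} (H : Finset (Sym2 (Fin k))) : Finset (Fin k) :=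
  Finset.univ.filter fun v => ∃ e ∈ H, v ∈ e

/-- `F` is a vertex-induced subgraph of `H`. -/
def IsInduced {k : ℕ} (F H : Finset (Sym2 (Fin k))) : Prop :=
  ∃ S : Finset (Fin k), ∀ e, e ∈ F ↔ e ∈ H ∧ ∀ v ∈ e, v ∈ S

/-- `F` is a core of `H`: a vertex-induced subgraph of `H` every minimum vertex cover
of which is a vertex cover of `H`. -/
def IsCore {k : ℕ} (F H : Finset (Sym2 (Fin k))) : Prop :=
  IsInduced F H ∧ ∀ S : Finset (Fin k), IsCover F S → S.card = vc F → IsCover H S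

/-- A graph on `[k]` (identified with its edge set) has no diagonal "edges". -/
def IsGraph {k : ℕ} (H : Finset (Sym2 (Fin k))) : Prop := ∀ e ∈ H, ¬ e.IsDiag

/-- The specification of the core map of Lemma 4.2: `core` maps every graph to one of its
cores, and for every `F` in the image of `core` we have `|V(E(F))| ≤ 3·vc(F)` and there is
an edge set `E*_F ⊆ V(E(F)) × ([k] ∖ V(E(F)))` (here provided by the function `Estar`)
such that `core H = F` iff `E(H) = E(F) ⊔ E` for some `E ⊆ E*_F`. -/
def CoreMapSpec (k : ℕ) (core Estar : Finset (Sym2 (Fin k)) → Finset (Sym2 (Fin k))) : Prop :=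
  (∀ H, IsGraph H → IsCore (core H) H) ∧
  ∀ F, (∃ H, IsGraph H ∧ core H = F) →
    (nonIsolated F).card ≤ 3 * vc F ∧
    (∀ e ∈ Estar F, ∃ u v, e = s(u, v) ∧ u ∈ nonIsolated F ∧ v ∉ nonIsolated F) ∧
    (∀ H, IsGraph H → (core H = F ↔ ∃ E ⊆ Estar F, Disjoint F E ∧ H = F ∪ E))

/-- The family `F_d` of cores of graphs on `[k]` with vertex cover at most `d`. -/
def coreSet {k : ℕ} (core : Finset (Sym2 (Fin k)) → Finset (Sym2 (Fin k))) (d : ℝ) :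
    Set (Finset (Sym2 (Fin k))) :=
  {F | ∃ H, IsGraph H ∧ (vc H : ℝ) ≤ d ∧ core H = F}

/-- The family `H_F = {F ⊔ E : E ⊆ E*_F}`. -/
def HFam {k : ℕ} (F EstarF : Finset (Sym2 (Fin k))) : Finset (Finset (Sym2 (Fin k))) :=
  EstarF.powerset.image fun E => F ∪ E

/-- `G` is `s`-bounded over `Q` and the core `F`. -/
noncomputable def SBounded {k n : ℕ} (p : ℝ) (G : Finset (Sym2 (Vtx k n)))
    (Q : Finset (Tup k n)) (F EstarF : Finset (Sym2 (Fin k))) (s : ℝ) : Prop :=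
  ((n : ℝ) ^ k)⁻¹ * |∑ t ∈ Q, ∑ H ∈ HFam F EstarF, chiE p G (graphOf H t)| ≤ s

/-- `G` is `(𝒬, D, δ)`-good. -/
noncomputable def Good {k n : ℕ} (p : ℝ)
    (core Estar : Finset (Sym2 (Fin k)) → Finset (Sym2 (Fin k)))
    (D δ : ℝ) (𝒬 : Finset (Finset (Tup k n))) (G : Finset (Sym2 (Vtx k n))) : Prop :=
  ∀ Q ∈ 𝒬, ∀ F ∈ coreSet core (D / 4), F.Nonempty →
    SBounded p G Q F (Estar F)
      ((n : ℝ) ^ (2 * (F.card : ℝ) / D - δ * (vc F : ℝ) / 10))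


lemma sym2_exists_mem {k : ℕ} (e : Sym2 (Fin k)) : ∃ v, v ∈ e := by
  induction e using Sym2.ind with
  | _ x y => exact ⟨x, Sym2.mem_mk_left x y⟩

lemma exists_min_cover {k : ℕ} (H : Finset (Sym2 (Fin k))) :
    ∃ S : Finset (Fin k), S.card = vc H ∧ IsCover H S := by
  have hne : {m | ∃ S : Finset (Fin k), S.card = m ∧ IsCover H S}.Nonempty := by
    refine ⟨_, Finset.univ, rfl, ?_⟩
    intro e _
    obtain ⟨v, hv⟩ := sym2_exists_mem e
    exact ⟨v, Finset.mem_univ v, hv⟩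
  exact Nat.sInf_mem hne

lemma vc_le_card {k : ℕ} {H : Finset (Sym2 (Fin k))} {S : Finset (Fin k)}
    (h : IsCover H S) : vc H ≤ S.card :=
  Nat.sInf_le ⟨S, rfl, h⟩

lemma vc_mono {k : ℕ} {F H : Finset (Sym2 (Fin k))} (h : F ⊆ H) : vc F ≤ vc H := by
  obtain ⟨S, hS, hc⟩ := exists_min_cover H
  rw [← hS]
  exact vc_le_card fun e he => hc e (h he)

lemma vc_empty {k : ℕ} : vc (∅ : Finset (Sym2 (Fin k))) = 0 := by
  have : vc (∅ : Finset (Sym2 (Fin k))) ≤ (∅ : Finset (Fin k)).card :=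
    vc_le_card (by intro e he; simp at he)
  simpa using this

lemma eq_empty_of_vc {k : ℕ} {H : Finset (Sym2 (Fin k))} (h : vc H = 0) : H = ∅ := by
  obtain ⟨S, hS, hc⟩ := exists_min_cover H
  rw [h, Finset.card_eq_zero] at hS
  subst hS
  refine Finset.eq_empty_of_forall_notMem fun e he => ?_
  obtain ⟨v, hv, _⟩ := hc e he
  simp at hv

lemma vc_insert_le {k : ℕ} (H : Finset (Sym2 (Fin k))) (e : Sym2 (Fin k)) :
    vc (insert e H) ≤ vc H + 1 := by
  obtain ⟨S, hS, hc⟩ := exists_min_cover H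
  obtain ⟨v, hv⟩ := sym2_exists_mem e
  rw [← hS]
  refine le_trans (vc_le_card (S := insert v S) ?_) (Finset.card_insert_le v S)
  intro e' he'
  rcases Finset.mem_insert.1 he' with rfl | h
  · exact ⟨v, Finset.mem_insert_self _ _, hv⟩
  · obtain ⟨w, hw, hwe⟩ := hc e' h
    exact ⟨w, Finset.mem_insert_of_mem hw, hwe⟩

lemma core_subset {k : ℕ} {F H : Finset (Sym2 (Fin k))} (h : IsCore F H) : F ⊆ H := by
  obtain ⟨⟨S, hS⟩, _⟩ := h
  exact fun e he => ((hS e).1 he).1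

lemma core_vc {k : ℕ} {F H : Finset (Sym2 (Fin k))} (h : IsCore F H) : vc F = vc H := by
  refine le_antisymm (vc_mono (core_subset h)) ?_
  obtain ⟨S, hS, hc⟩ := exists_min_cover F
  rw [← hS]
  exact vc_le_card (h.2 S hc hS)

lemma core_insert {k : ℕ} {F H H0 : Finset (Sym2 (Fin k))} {e : Sym2 (Fin k)} {d : ℝ}
    (h : IsCore F H) (h0 : IsCore F H0) (hd : (vc H0 : ℝ) ≤ d)
    (hd' : d < vc (insert e H0)) : d < vc (insert e H) := by
  by_contra hcon
  push Not at hcon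
  obtain ⟨S, hS, hc⟩ := exists_min_cover (insert e H)
  have h1 := core_vc h0
  have h2 : ((vc (insert e H0) : ℕ) : ℝ) ≤ (vc H0 : ℝ) + 1 := by
    exact_mod_cast vc_insert_le H0 e
  have h3 : S.card < vc H0 + 1 := by
    have : (S.card : ℝ) < (vc H0 : ℝ) + 1 := by rw [hS]; linarith
    exact_mod_cast this
  have hcF : IsCover F S := fun e' he' =>
    hc e' (Finset.mem_insert_of_mem (core_subset h he'))
  have h4 := vc_le_card hcF
  have h5 : IsCover H0 S := h0.2 S hcF (by omega)
  have h6 : IsCover (insert e H0) S := by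
    intro e' he'
    rcases Finset.mem_insert.1 he' with rfl | h'
    · exact hc _ (Finset.mem_insert_self _ _)
    · exact h5 e' h'
  have h7 : ((vc (insert e H0) : ℕ) : ℝ) ≤ S.card := by exact_mod_cast vc_le_card h6
  rw [hS] at h7
  linarith

lemma graphOf_map_inj {k n : ℕ} (t : Tup k n) :
    Function.Injective (Sym2.map fun i : Fin k => ((i, t i) : Vtx k n)) :=
  Sym2.map.injective fun a b hab => (Prod.mk.inj hab).1

lemma chiE_insert {k n : ℕ} (p : ℝ) (G : Finset (Sym2 (Vtx k n))) (t : Tup k n)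
    (H : Finset (Sym2 (Fin k))) (e : Sym2 (Fin k)) (he : e ∉ H)
    (heG : Sym2.map (fun i => (i, t i)) e ∉ G) :
    chiE p G (graphOf (insert e H) t) = - chiE p G (graphOf H t) := by
  unfold chiE graphOf
  rw [Finset.prod_image (fun a _ b _ h => graphOf_map_inj t h),
    Finset.prod_image (fun a _ b _ h => graphOf_map_inj t h), Finset.prod_insert he]
  simp [heG]

open Classical in
/-- The graphs whose contribution is not cancelled by toggling `e`. -/
noncomputable def badSet (k : ℕ) (e : Sym2 (Fin k)) (d : ℝ) :
    Finset (Finset (Sym2 (Fin k))) :=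
  Finset.univ.filter fun H => IsGraph H ∧ (vc H : ℝ) ≤ d ∧ d < vc (insert e H)

open Classical in
lemma cancel {k n : ℕ} (p : ℝ) (G : Finset (Sym2 (Vtx k n))) (t : Tup k n)
    (e : Sym2 (Fin k)) (hediag : ¬ e.IsDiag) (d : ℝ)
    (heG : Sym2.map (fun i => (i, t i)) e ∉ G) :
    ∑ H ∈ Finset.univ.filter
        (fun H : Finset (Sym2 (Fin k)) => (∀ e ∈ H, ¬ e.IsDiag) ∧ (vc H : ℝ) ≤ d),
      chiE p G (graphOf H t) = ∑ H ∈ badSet k e d, chiE p G (graphOf H t) := by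
  rw [← Finset.sum_filter_add_sum_filter_not _ (fun H => d < (vc (insert e H) : ℝ))]
  have h1 : (Finset.univ.filter
        (fun H : Finset (Sym2 (Fin k)) => (∀ e ∈ H, ¬ e.IsDiag) ∧ (vc H : ℝ) ≤ d)).filter
        (fun H => d < (vc (insert e H) : ℝ)) = badSet k e d := by
    ext H
    simp only [badSet, Finset.mem_filter, Finset.mem_univ, true_and, and_assoc]
    rfl
  rw [h1]
  simp only [add_eq_left]
  refine Finset.sum_involution
    (fun H _ => if e ∈ H then H.erase e else insert e H) ?_ ?_ ?_ ?_
  · intro H _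
    by_cases he : e ∈ H
    · simp only [he, if_true]
      have := chiE_insert p G t (H.erase e) e (Finset.notMem_erase e H) heG
      rw [Finset.insert_erase he] at this
      rw [this]; ring
    · simp only [he, if_false]
      rw [chiE_insert p G t H e he heG]; ring
  · intro H _ _ heq
    by_cases he : e ∈ H
    · simp only [he, if_true] at heq
      exact Finset.notMem_erase e H (by rw [heq]; exact he)
    · simp only [he, if_false] at heq
      exact he (by rw [← heq]; exact Finset.mem_insert_self _ _)
  · intro H hH
    simp only [Finset.mem_filter, Finset.mem_univ, true_and, not_lt] at hH ⊢
    obtain ⟨⟨hg, hv⟩, hi⟩ := hH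
    by_cases he : e ∈ H
    · simp only [he, if_true]
      refine ⟨⟨fun e' he' => hg e' (Finset.mem_of_mem_erase he'), ?_⟩, ?_⟩
      · have : ((vc (H.erase e) : ℕ) : ℝ) ≤ vc H := by
          exact_mod_cast vc_mono (Finset.erase_subset e H)
        linarith
      · rw [Finset.insert_erase he]; exact hv
    · simp only [he, if_false]
      refine ⟨⟨?_, hi⟩, by simpa using hi⟩
      intro e' he'
      rcases Finset.mem_insert.1 he' with rfl | h'
      · exact hediag
      · exact hg e' h'
  · intro H _
    by_cases he : e ∈ H
    · simp [he, Finset.insert_erase he]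
    · simp [he, Finset.erase_insert he]

lemma mem_HFam {k : ℕ} {core Estar : Finset (Sym2 (Fin k)) → Finset (Sym2 (Fin k))}
    (hs : CoreMapSpec k core Estar) {H0 : Finset (Sym2 (Fin k))} (h0 : IsGraph H0)
    (H : Finset (Sym2 (Fin k))) :
    H ∈ HFam (core H0) (Estar (core H0)) ↔ IsGraph H ∧ core H = core H0 := by
  obtain ⟨_, hE, hH⟩ := hs.2 (core H0) ⟨H0, h0, rfl⟩
  have hFg : IsGraph (core H0) := fun e he => h0 e (core_subset (hs.1 H0 h0) he)
  unfold HFam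
  simp only [Finset.mem_image, Finset.mem_powerset]
  constructor
  · rintro ⟨E, hEs, rfl⟩
    have hg : IsGraph (core H0 ∪ E) := by
      intro e he
      rcases Finset.mem_union.1 he with h | h
      · exact hFg e h
      · obtain ⟨u, v, rfl, hu, hv⟩ := hE e (hEs h)
        simp only [Sym2.mk_isDiag_iff]
        rintro rfl
        exact hv hu
    refine ⟨hg, (hH _ hg).2 ⟨E, hEs, ?_, rfl⟩⟩
    rw [Finset.disjoint_left]
    intro e he1 he2
    obtain ⟨u, v, rfl, hu, hv⟩ := hE e (hEs he2)
    exact hv (by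
      simp only [nonIsolated, Finset.mem_filter, Finset.mem_univ, true_and]
      exact ⟨_, he1, Sym2.mem_mk_right u v⟩)
  · rintro ⟨hg, hc⟩
    obtain ⟨E, hEs, _, hEq⟩ := (hH H hg).1 hc
    exact ⟨E, hEs, hEq.symm⟩

open Classical in
lemma group_sum {k : ℕ} {core Estar : Finset (Sym2 (Fin k)) → Finset (Sym2 (Fin k))}
    (hs : CoreMapSpec k core Estar) (e : Sym2 (Fin k)) (d : ℝ)
    (f : Finset (Sym2 (Fin k)) → ℝ) :
    ∑ H ∈ badSet k e d, f H =
      ∑ F ∈ (badSet k e d).image core, ∑ H ∈ HFam F (Estar F), f H := by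
  rw [← Finset.sum_fiberwise_of_maps_to
    (fun H hH => Finset.mem_image_of_mem core hH) f]
  refine Finset.sum_congr rfl fun F hF => ?_
  obtain ⟨H0, hH0, rfl⟩ := Finset.mem_image.1 hF
  refine Finset.sum_congr ?_ fun _ _ => rfl
  simp only [badSet, Finset.mem_filter, Finset.mem_univ, true_and] at hH0
  obtain ⟨hg0, hv0, hi0⟩ := hH0
  ext H
  rw [mem_HFam hs hg0, Finset.mem_filter]
  simp only [badSet, Finset.mem_filter, Finset.mem_univ, true_and]
  constructor
  · rintro ⟨⟨hg, _⟩, hc⟩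
    exact ⟨hg, hc⟩
  · rintro ⟨hg, hc⟩
    have c1 := hs.1 H hg
    have c0 := hs.1 H0 hg0
    rw [hc] at c1
    refine ⟨⟨hg, ?_, core_insert c1 c0 hv0 hi0⟩, hc⟩
    rw [← core_vc c1, core_vc c0]
    exact hv0

lemma param_core {k : ℕ} (hk : 0 < k) {F : Finset (Sym2 (Fin k))} {N : ℕ}
    (h : (nonIsolated F).card ≤ N) (hN : 0 < N) :
    ∃ f : Fin N → Fin k, ∃ A : Finset (Sym2 (Fin N)), A.image (Sym2.map f) = F := by
  classical
  have hs : ∃ f : Fin N → Fin k, ∀ v ∈ nonIsolated F, ∃ x, f x = v := by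
    let g := (nonIsolated F).equivFin
    refine ⟨fun x => if hx : x.1 < (nonIsolated F).card then (g.symm ⟨x.1, hx⟩).1
      else ⟨0, hk⟩, fun v hv => ?_⟩
    refine ⟨⟨(g ⟨v, hv⟩).1, lt_of_lt_of_le (g ⟨v, hv⟩).2 h⟩, ?_⟩
    simp
  obtain ⟨f, hf⟩ := hs
  refine ⟨f, Finset.univ.filter fun a => Sym2.map f a ∈ F, ?_⟩
  ext e
  simp only [Finset.mem_image, Finset.mem_filter, Finset.mem_univ, true_and]
  constructor
  · rintro ⟨a, ha, rfl⟩
    exact ha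
  · intro he
    induction e using Sym2.ind with
    | _ x y =>
      obtain ⟨a, ha⟩ := hf x (by
        simp only [nonIsolated, Finset.mem_filter, Finset.mem_univ, true_and]
        exact ⟨_, he, Sym2.mem_mk_left x y⟩)
      obtain ⟨b, hb⟩ := hf y (by
        simp only [nonIsolated, Finset.mem_filter, Finset.mem_univ, true_and]
        exact ⟨_, he, Sym2.mem_mk_right x y⟩)
      exact ⟨s(a, b), by simpa [ha, hb] using he, by simp [ha, hb]⟩

lemma card_sym2_le {m : ℕ} (hm : 0 < m) : Fintype.card (Sym2 (Fin (3 * m))) ≤ 6 * m ^ 2 := by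
  rw [Sym2.card, Fintype.card_fin, Nat.choose_two_right]
  simp only [Nat.add_sub_cancel]
  apply Nat.div_le_of_le_mul
  nlinarith

lemma core_card_le {k : ℕ} (hk : 0 < k) {F : Finset (Sym2 (Fin k))} {m : ℕ} (hm : 0 < m)
    (h : (nonIsolated F).card ≤ 3 * m) : F.card ≤ 6 * m ^ 2 := by
  obtain ⟨f, A, rfl⟩ := param_core hk h (by omega)
  exact le_trans Finset.card_image_le (le_trans (Finset.card_le_univ A) (card_sym2_le hm))

lemma core_family_card {k : ℕ} (hk : 0 < k) {m : ℕ} (hm : 0 < m)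
    (𝓕 : Finset (Finset (Sym2 (Fin k))))
    (h : ∀ F ∈ 𝓕, (nonIsolated F).card ≤ 3 * m) :
    𝓕.card ≤ k ^ (3 * m) * 2 ^ (6 * m ^ 2) := by
  classical
  have hsub : 𝓕 ⊆ (Finset.univ : Finset ((Fin (3 * m) → Fin k) ×
      Finset (Sym2 (Fin (3 * m))))).image fun q => q.2.image (Sym2.map q.1) := by
    intro F hF
    obtain ⟨f, A, hA⟩ := param_core hk (h F hF) (by omega)
    exact Finset.mem_image.2 ⟨(f, A), Finset.mem_univ _, hA⟩
  refine le_trans (Finset.card_le_card hsub) (le_trans Finset.card_image_le ?_)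
  rw [Finset.card_univ, Fintype.card_prod, Fintype.card_fun, Fintype.card_finset,
    Fintype.card_fin, Fintype.card_fin]
  exact Nat.mul_le_mul_left _ (Nat.pow_le_pow_right (by norm_num) (card_sym2_le hm))

lemma ruled_card {k n : ℕ} (Q : Finset (Tup k n)) (i j : Fin k) (hij : i ≠ j) (a b : Fin n)
    (h : ∀ t ∈ Q, t i = a ∧ t j = b) : Q.card * n ^ 2 ≤ n ^ k := by
  classical
  have hle : (Q ×ˢ (Finset.univ : Finset (Fin n × Fin n))).card ≤
      (Finset.univ : Finset (Tup k n)).card := by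
    refine Finset.card_le_card_of_injOn
      (fun q => Function.update (Function.update q.1 i q.2.1) j q.2.2)
      (fun _ _ => Finset.mem_coe.2 (Finset.mem_univ _)) ?_
    rintro ⟨t, x, y⟩ h1 ⟨t', x', y'⟩ h2 heq
    simp only [Finset.coe_product, Set.mem_prod, Finset.mem_coe] at h1 h2
    have e1 := h t h1.1
    have e2 := h t' h2.1
    have hj := congrFun heq j
    have hi := congrFun heq i
    simp [hij] at hi hj
    subst hi hj
    have : t = t' := by
      funext l
      by_cases hl : l = j
      · rw [hl, e1.2, e2.2]
      · by_cases hl' : l = i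
        · rw [hl', e1.1, e2.1]
        · simpa [hl, hl'] using congrFun heq l
    rw [this]
  simpa [Finset.card_product, Fintype.card_prod, pow_two] using hle

lemma numeric {k n m N : ℕ} {ε δ D : ℝ} (hn : 2 ≤ n) (hε : 0 < ε) (hδ : 1000 * ε < δ)
    (hD : 0 < D) (hk : (k : ℝ) < (n : ℝ) ^ (δ / 60)) (hDn : D ≤ 2 * Real.logb 2 n)
    (hmd : (m : ℝ) ≤ ε * D) (hN : N ≤ k ^ (3 * m) * 2 ^ (6 * m ^ 2)) :
    (N : ℝ) * (n : ℝ) ^ (2 * (6 * (m : ℝ) ^ 2) / D - δ * m / 10) ≤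
      (n : ℝ) ^ (-(δ * m / 40)) := by
  have hn0 : (0 : ℝ) < n := by positivity
  have hn1 : (1 : ℝ) ≤ n := by exact_mod_cast (by omega : 1 ≤ n)
  have hm0 : (0 : ℝ) ≤ m := by positivity
  have hlog : (2 : ℝ) ^ (Real.logb 2 n) = n :=
    Real.rpow_logb (by norm_num) (by norm_num) hn0
  have hA : ((k : ℝ) ^ (3 * m)) ≤ (n : ℝ) ^ (δ * m / 20) := by
    calc (k : ℝ) ^ (3 * m) ≤ ((n : ℝ) ^ (δ / 60)) ^ (3 * m) :=
          pow_le_pow_left₀ (by positivity) hk.le _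
      _ = (n : ℝ) ^ (δ * m / 20) := by
          rw [← Real.rpow_natCast, ← Real.rpow_mul hn0.le]
          congr 1; push_cast; ring
  have hB : ((2 : ℝ) ^ (6 * m ^ 2)) ≤ (n : ℝ) ^ (12 * ε * m) := by
    calc (2 : ℝ) ^ (6 * m ^ 2) = (2 : ℝ) ^ (6 * (m : ℝ) ^ 2) := by
          rw [← Real.rpow_natCast]; push_cast; rfl
      _ ≤ (2 : ℝ) ^ (Real.logb 2 n * (12 * ε * m)) := by
          apply Real.rpow_le_rpow_of_exponent_le (by norm_num)
          have h1 : (m : ℝ) ≤ ε * (2 * Real.logb 2 n) :=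
            hmd.trans (mul_le_mul_of_nonneg_left hDn hε.le)
          nlinarith [mul_le_mul_of_nonneg_left h1 hm0]
      _ = (n : ℝ) ^ (12 * ε * m) := by
          rw [Real.rpow_mul (by norm_num), hlog]
  have hNr : (N : ℝ) ≤ (n : ℝ) ^ (δ * m / 20) * (n : ℝ) ^ (12 * ε * m) := by
    calc (N : ℝ) ≤ (k : ℝ) ^ (3 * m) * 2 ^ (6 * m ^ 2) := by exact_mod_cast hN
      _ ≤ _ := mul_le_mul hA hB (by positivity) (by positivity)
  have hE : 2 * (6 * (m : ℝ) ^ 2) / D ≤ 12 * ε * m := by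
    rw [div_le_iff₀ hD]
    nlinarith [mul_le_mul_of_nonneg_left hmd hm0]
  calc (N : ℝ) * (n : ℝ) ^ (2 * (6 * (m : ℝ) ^ 2) / D - δ * m / 10)
      ≤ ((n : ℝ) ^ (δ * m / 20) * (n : ℝ) ^ (12 * ε * m)) *
          (n : ℝ) ^ (12 * ε * m - δ * m / 10) := by
        refine mul_le_mul hNr ?_ (by positivity) (by positivity)
        exact Real.rpow_le_rpow_of_exponent_le hn1 (by linarith)
    _ = (n : ℝ) ^ (δ * m / 20 + 12 * ε * m + (12 * ε * m - δ * m / 10)) := by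
        rw [Real.rpow_add hn0, Real.rpow_add hn0]
    _ ≤ _ := by
        apply Real.rpow_le_rpow_of_exponent_le hn1
        nlinarith [mul_le_mul_of_nonneg_right hδ.le hm0]

/-- Lemma 5.5: there is a constant `c > 0` such that for all
sufficiently small `ε > 0` and all reals `d, D, δ > 0` and integers `k, n` satisfying
`δ > cε`, `k < n^{δ/60}`, `D ≤ 2 log n` and `d = εD`, and any family `𝒬 ⊆ 2^T` with
`|𝒬| ≤ exp(n^{2−δ})`: if a `k`-partite graph `G` is `(𝒬, D, δ)`-good, then every
`Q ∈ 𝒬` ruled out by a missing edge satisfies `μ_{G,d}(Q) ≤ n^{−c'·ε²·D}` for a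
constant `c' > 0` depending only on `ε, δ`. -/
theorem measure_small_on_ruled_out_sets :
    ∃ c > (0 : ℝ), ∃ ε₀ > (0 : ℝ), ∀ ε : ℝ, 0 < ε → ε ≤ ε₀ →
      ∀ δ : ℝ, c * ε < δ →
        ∃ c' > (0 : ℝ), ∀ k n : ℕ, ∀ d D : ℝ,
          0 < d → 0 < D → d = ε * D →
          (k : ℝ) < (n : ℝ) ^ (δ / 60) → D ≤ 2 * Real.logb 2 n →
          ∀ core Estar : Finset (Sym2 (Fin k)) → Finset (Sym2 (Fin k)),
            CoreMapSpec k core Estar →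
            ∀ 𝒬 : Finset (Finset (Tup k n)),
              (𝒬.card : ℝ) ≤ Real.exp ((n : ℝ) ^ (2 - δ)) →
              ∀ G ⊆ potEdges k n,
                Good ((n : ℝ) ^ (-(2 : ℝ) / D)) core Estar D δ 𝒬 G →
                ∀ Q ∈ 𝒬, RuledOut G Q →
                  muSet ((n : ℝ) ^ (-(2 : ℝ) / D)) G d Q ≤
                    (n : ℝ) ^ (-(c' * ε ^ 2 * D)) := by
  classical
  refine ⟨1000, by norm_num, 1 / 4, by norm_num, ?_⟩
  intro ε hε hε0 δ hδ
  have hδ0 : 0 < δ := by linarith [mul_pos (by norm_num : (0 : ℝ) < 1000) hε]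
  refine ⟨min (δ / (80 * ε)) (2 / ε), by positivity, ?_⟩
  intro k n d D hd hD hdD hk hDn core Estar hs 𝒬 _ G _ hgood Q hQ hruled
  set p : ℝ := (n : ℝ) ^ (-(2 : ℝ) / D) with hp
  obtain ⟨e', he', heG, het⟩ := hruled
  -- the missing edge
  obtain ⟨i, j, a, b, rfl⟩ : ∃ (i j : Fin k) (a b : Fin n), e' = s((i, a), (j, b)) := by
    induction e' using Sym2.ind with
    | _ x y => exact ⟨x.1, y.1, x.2, y.2, rfl⟩
  have hij : i ≠ j := by simpa [potEdges] using he'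
  have hta : ∀ t ∈ Q, t i = a ∧ t j = b := fun t ht =>
    ⟨het t ht (i, a) (by simp), het t ht (j, b) (by simp)⟩
  have hk2 : 2 ≤ k := by
    have h1 := i.2
    have h2 := j.2
    have h3 : i.1 ≠ j.1 := fun h => hij (Fin.ext h)
    omega
  have hn2 : 2 ≤ n := by
    by_contra hcon
    have hk2' : (2 : ℝ) ≤ k := by exact_mod_cast hk2
    have hn1 : (n : ℝ) ≤ 1 := by exact_mod_cast (by omega : n ≤ 1)
    have : (n : ℝ) ^ (δ / 60) ≤ 1 :=
      Real.rpow_le_one (by positivity) hn1 (by positivity)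
    linarith
  have hn0 : (0 : ℝ) < n := by positivity
  have hn1 : (1 : ℝ) ≤ n := by exact_mod_cast (by omega : 1 ≤ n)
  rcases lt_or_ge d 1 with hd1 | hd1
  · -- trivial range: only the empty graph contributes
    have hmu : ∀ t : Tup k n, mu p G d t = ((n : ℝ) ^ k)⁻¹ := by
      intro t
      unfold mu
      have : (Finset.univ.filter
          (fun H : Finset (Sym2 (Fin k)) => (∀ e ∈ H, ¬ e.IsDiag) ∧ (vc H : ℝ) ≤ d)) = {∅} := by
        ext H
        simp only [Finset.mem_filter, Finset.mem_univ, true_and, Finset.mem_singleton]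
        constructor
        · rintro ⟨_, hv⟩
          apply eq_empty_of_vc
          have : (vc H : ℝ) < 1 := by linarith
          have : vc H < 1 := by exact_mod_cast this
          omega
        · rintro rfl
          simp [vc_empty, hd.le]
      rw [this]
      simp [chiE, graphOf]
    have hcard := ruled_card Q i j hij a b hta
    have hcard' : (Q.card : ℝ) * (n : ℝ) ^ 2 ≤ (n : ℝ) ^ k := by exact_mod_cast hcard
    calc muSet p G d Q = Q.card * ((n : ℝ) ^ k)⁻¹ := by
          unfold muSet
          rw [Finset.sum_congr rfl fun t _ => hmu t]
          simp
      _ ≤ ((n : ℝ) ^ 2)⁻¹ := by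
          rw [← div_eq_mul_inv, div_le_iff₀ (by positivity), inv_mul_eq_div,
            le_div_iff₀ (by positivity)]
          exact hcard'
      _ = (n : ℝ) ^ (-2 : ℝ) := by
          rw [Real.rpow_neg hn0.le]; norm_num
      _ ≤ _ := by
          apply Real.rpow_le_rpow_of_exponent_le hn1
          have h1 : min (δ / (80 * ε)) (2 / ε) * ε ^ 2 * D ≤ 2 / ε * ε ^ 2 * D := by
            gcongr
            exact min_le_right _ _
          have h2 : 2 / ε * ε ^ 2 * D = 2 * d := by rw [hdD]; field_simp
          linarith
  · -- main range
    set e : Sym2 (Fin k) := s(i, j) with he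
    set 𝓕 := (badSet k e d).image core with h𝓕
    obtain ⟨m, hm⟩ : ∃ m, m = ⌊d⌋₊ := ⟨_, rfl⟩
    have hm1 : 0 < m := by rw [hm]; exact Nat.floor_pos.2 hd1
    have hmd : (m : ℝ) ≤ d := by rw [hm]; exact Nat.floor_le hd.le
    have hmd2 : d < (m : ℝ) + 1 := by rw [hm]; exact Nat.lt_floor_add_one d
    have hF : ∀ F ∈ 𝓕, (nonIsolated F).card ≤ 3 * m ∧ vc F = m ∧
        F ∈ coreSet core (D / 4) ∧ F.Nonempty := by
      intro F hF
      obtain ⟨H0, hH0, rfl⟩ := Finset.mem_image.1 hF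
      simp only [badSet, Finset.mem_filter, Finset.mem_univ, true_and] at hH0
      obtain ⟨hg0, hv0, hi0⟩ := hH0
      have hvc := core_vc (hs.1 H0 hg0)
      have h1 : ((vc (insert e H0) : ℕ) : ℝ) ≤ (vc H0 : ℝ) + 1 := by
        exact_mod_cast vc_insert_le H0 e
      have h2 : vc (core H0) = m := by
        rw [hvc, hm]
        symm
        rw [Nat.floor_eq_iff hd.le]
        exact ⟨hv0, by linarith⟩
      refine ⟨?_, h2, ⟨H0, hg0, ?_, rfl⟩, ?_⟩
      · rw [← h2]
        exact (hs.2 _ ⟨H0, hg0, rfl⟩).1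
      · have : ε * D ≤ 1 / 4 * D := mul_le_mul_of_nonneg_right hε0 hD.le
        linarith
      · rw [Finset.nonempty_iff_ne_empty]
        intro h0
        rw [h0, vc_empty] at h2
        omega
    have hsum : muSet p G d Q = ∑ F ∈ 𝓕, ((n : ℝ) ^ k)⁻¹ *
        ∑ t ∈ Q, ∑ H ∈ HFam F (Estar F), chiE p G (graphOf H t) := by
      unfold muSet
      rw [← Finset.mul_sum, Finset.sum_comm, Finset.mul_sum]
      refine Finset.sum_congr rfl fun t ht => ?_
      unfold mu
      congr 1
      rw [← group_sum hs e d (fun H => chiE p G (graphOf H t))]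
      refine Eq.trans ?_ (cancel p G t e (by simpa [he] using hij) d ?_)
      · exact Finset.sum_congr (by congr) fun _ _ => rfl
      · obtain ⟨h1, h2⟩ := hta t ht
        simpa [he, h1, h2] using heG
    have hbound : ∀ F ∈ 𝓕, ((n : ℝ) ^ k)⁻¹ *
        ∑ t ∈ Q, ∑ H ∈ HFam F (Estar F), chiE p G (graphOf H t) ≤
        (n : ℝ) ^ (2 * (6 * (m : ℝ) ^ 2) / D - δ * m / 10) := by
      intro F hFm
      obtain ⟨h1, h2, h3, h4⟩ := hF F hFm
      have hb := hgood Q hQ F h3 h4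
      unfold SBounded at hb
      refine le_trans (mul_le_mul_of_nonneg_left (le_abs_self _) (by positivity))
        (le_trans hb ?_)
      apply Real.rpow_le_rpow_of_exponent_le hn1
      have hc : (F.card : ℝ) ≤ 6 * (m : ℝ) ^ 2 := by
        exact_mod_cast core_card_le (by omega) hm1 h1
      rw [h2]
      gcongr
    have hcard := core_family_card (by omega) hm1 𝓕 fun F h => (hF F h).1
    calc muSet p G d Q ≤ 𝓕.card • (n : ℝ) ^ (2 * (6 * (m : ℝ) ^ 2) / D - δ * m / 10) := by
          rw [hsum]
          exact Finset.sum_le_card_nsmul _ _ _ hbound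
      _ = (𝓕.card : ℝ) * (n : ℝ) ^ (2 * (6 * (m : ℝ) ^ 2) / D - δ * m / 10) := by
          rw [nsmul_eq_mul]
      _ ≤ (n : ℝ) ^ (-(δ * m / 40)) :=
          numeric hn2 hε hδ hD hk hDn (by rw [← hdD]; exact hmd) hcard
      _ ≤ _ := by
          apply Real.rpow_le_rpow_of_exponent_le hn1
          have h1 : min (δ / (80 * ε)) (2 / ε) * ε ^ 2 * D ≤ δ / (80 * ε) * ε ^ 2 * D := by
            gcongr
            exact min_le_left _ _
          have h2 : δ / (80 * ε) * ε ^ 2 * D = δ * d / 80 := by rw [hdD]; field_simp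
          have hm1' : (1 : ℝ) ≤ m := by exact_mod_cast hm1
          have h3 : d ≤ 2 * m := by linarith
          have h4 : δ * d ≤ δ * (2 * m) := mul_le_mul_of_nonneg_left h3 hδ0.le
          linarith
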